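/- arXiv:2009.10681 — 4 statements merged into one kernel-verified Lean document; each statement's English description precedes it below -/
import Mathlib

section
/- Let n ≥ 1, let (a,b) ⊆ ℝ be an open interval, let B0, B1 : (a,b) → ℂ^{2n×2n} be such that B0(x) and B1(x) are Hermitian for every x ∈ (a,b), fix λ ∈ ℂ with Im λ ≠ 0, and suppose Φ : (a,b) → ℂ^{2n×2n} is differentiable with J Φ'(x) = (B0(x) + λ B1(x)) Φ(x) for all x ∈ (a,b). Define A(x) := (1/(2 Im λ)) Φ(x)* (J/i) Φ(x). Then A is differentiable on (a,b) and A'(x) = Φ(x)* B1(x) Φ(x) for all x ∈ (a,b); moreover A(x) is Hermitian for every x ∈ (a,b). -/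
open Matrix Set

noncomputable section

/-- The standard `2n × 2n` complex symplectic matrix `J = [[0, -I],[I, 0]]`. -/
def stdJ (n : ℕ) : Matrix (Fin n ⊕ Fin n) (Fin n ⊕ Fin n) ℂ :=
  Matrix.fromBlocks 0 (-1) 1 0

/-- The Hermitian matrix `J/i = -iJ`. -/
def stdJi (n : ℕ) : Matrix (Fin n ⊕ Fin n) (Fin n ⊕ Fin n) ℂ :=
  (-Complex.I) • stdJ n

/-- Niessen's matrix `A(x;λ) = (1/(2 Im λ)) Φ(x)* (J/i) Φ(x)`. -/
def calA (n : ℕ) (lam : ℂ) (Φ : ℝ → Matrix (Fin n ⊕ Fin n) (Fin n ⊕ Fin n) ℂ)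
    (x : ℝ) : Matrix (Fin n ⊕ Fin n) (Fin n ⊕ Fin n) ℂ :=
  (1 / (2 * (lam.im : ℂ))) • ((Φ x)ᴴ * stdJi n * Φ x)

/-- Entrywise product rule for matrix-valued functions. -/
theorem hasDerivAt_matrix_mul_apply {l m k : Type*} [Fintype m] {F : ℝ → Matrix l m ℂ}
    {G : ℝ → Matrix m k ℂ} {F' : Matrix l m ℂ} {G' : Matrix m k ℂ} {x : ℝ}
    (hF : ∀ i j, HasDerivAt (fun t => F t i j) (F' i j) x)
    (hG : ∀ i j, HasDerivAt (fun t => G t i j) (G' i j) x) (i : l) (j : k) :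
    HasDerivAt (fun t => (F t * G t) i j) ((F' * G x + F x * G') i j) x := by
  simp only [Matrix.mul_apply, Matrix.add_apply, ← Finset.sum_add_distrib]
  exact HasDerivAt.fun_sum fun r _ => (hF i r).fun_mul (hG r j)

theorem conjTranspose_stdJ (n : ℕ) : (stdJ n)ᴴ = -stdJ n := by
  simp [stdJ, Matrix.fromBlocks_conjTranspose, Matrix.fromBlocks_neg]

theorem isHermitian_stdJi (n : ℕ) : (stdJi n).IsHermitian := by
  simp [Matrix.IsHermitian, stdJi, conjTranspose_stdJ]

theorem isHermitian_calA (n : ℕ) (lam : ℂ)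
    (Φ : ℝ → Matrix (Fin n ⊕ Fin n) (Fin n ⊕ Fin n) ℂ) (x : ℝ) :
    (calA n lam Φ x).IsHermitian := by
  simp [Matrix.IsHermitian, calA, (isHermitian_stdJi n).eq, Matrix.mul_assoc]

/-- Lagrange's identity for a solution of the Hamiltonian system at one point. -/
theorem lagrange_identity {n : ℕ} {B0 B1 P D : Matrix (Fin n ⊕ Fin n) (Fin n ⊕ Fin n) ℂ}
    {lam : ℂ} (hB0 : B0.IsHermitian) (hB1 : B1.IsHermitian)
    (hP : stdJ n * D = (B0 + lam • B1) * P) :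
    Dᴴ * stdJi n * P + Pᴴ * stdJi n * D = (2 * (lam.im : ℂ)) • (Pᴴ * B1 * P) := by
  have hD : Dᴴ * stdJ n = -(Pᴴ * (B0 + star lam • B1)) := by
    have h := congrArg Matrix.conjTranspose hP
    simp only [Matrix.conjTranspose_mul, Matrix.conjTranspose_add, Matrix.conjTranspose_smul,
      hB0.eq, hB1.eq, conjTranspose_stdJ, Matrix.mul_neg] at h
    rw [← h, neg_neg]
  have hc : 2 * (lam.im : ℂ) = -Complex.I * (lam - star lam) := by
    apply Complex.ext <;> simp <;> ring
  rw [stdJi, Matrix.mul_smul, hD, Matrix.mul_smul, Matrix.smul_mul, Matrix.smul_mul,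
    Matrix.mul_assoc Pᴴ (stdJ n), hP, hc, mul_smul, ← smul_add]
  congr 1
  simp only [Matrix.neg_mul, Matrix.mul_add, Matrix.add_mul, Matrix.mul_smul, Matrix.smul_mul,
    Matrix.mul_assoc, sub_smul]
  abel

/-- For a fundamental solution `Φ` of the Hamiltonian system with `Im λ ≠ 0`, the matrix
`A(x) = (1/(2 Im λ)) Φ(x)* (J/i) Φ(x)` is differentiable with `A'(x) = Φ(x)* B1(x) Φ(x)`,
and `A(x)` is Hermitian for every `x ∈ (a,b)`. -/
theorem calA_hasDerivAt_and_isHermitian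
    (n : ℕ) (hn : 1 ≤ n) (a b : ℝ) (hab : a < b)
    (B0 B1 : ℝ → Matrix (Fin n ⊕ Fin n) (Fin n ⊕ Fin n) ℂ)
    (hB0 : ∀ x ∈ Ioo a b, (B0 x).IsHermitian)
    (hB1 : ∀ x ∈ Ioo a b, (B1 x).IsHermitian)
    (lam : ℂ) (hlam : lam.im ≠ 0)
    (Φ DΦ : ℝ → Matrix (Fin n ⊕ Fin n) (Fin n ⊕ Fin n) ℂ)
    (hΦ : ∀ x ∈ Ioo a b, ∀ i j, HasDerivAt (fun t => Φ t i j) (DΦ x i j) x)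
    (hODE : ∀ x ∈ Ioo a b, stdJ n * DΦ x = (B0 x + lam • B1 x) * Φ x) :
    (∀ x ∈ Ioo a b, ∀ i j,
      HasDerivAt (fun t => calA n lam Φ t i j) (((Φ x)ᴴ * B1 x * Φ x) i j) x) ∧
    (∀ x ∈ Ioo a b, (calA n lam Φ x).IsHermitian) := by
  refine ⟨fun x hx i j => ?_, fun x _ => isHermitian_calA n lam Φ x⟩
  have hstar : ∀ i j, HasDerivAt (fun t => (Φ t)ᴴ i j) ((DΦ x)ᴴ i j) x :=
    fun i j => (hΦ x hx j i).star
  have hconst : ∀ i j, HasDerivAt (fun _ : ℝ => stdJi n i j)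
      ((0 : Matrix (Fin n ⊕ Fin n) (Fin n ⊕ Fin n) ℂ) i j) x :=
    fun i j => hasDerivAt_const x _
  have h := (hasDerivAt_matrix_mul_apply (hasDerivAt_matrix_mul_apply hstar hconst)
    (hΦ x hx) i j).const_mul (1 / (2 * (lam.im : ℂ)))
  have hne : 2 * (lam.im : ℂ) ≠ 0 := by simpa using hlam
  rw [Matrix.mul_zero, add_zero, lagrange_identity (hB0 x hx) (hB1 x hx) (hODE x hx),
    Matrix.smul_apply, smul_eq_mul, ← mul_assoc, one_div_mul_cancel hne, one_mul] at h
  exact h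
end
end

section
/- Let n ≥ 1, let (a,b) ⊆ ℝ be an open interval, let B0, B1 : (a,b) → ℂ^{2n×2n} be such that B0(x) and B1(x) are Hermitian for every x ∈ (a,b), fix c ∈ (a,b) and λ ∈ ℂ with Im λ ≠ 0, and suppose Φ_λ, Φ_λ̄ : (a,b) → ℂ^{2n×2n} are differentiable solutions of J Φ_λ' = (B0(x) + λ B1(x)) Φ_λ and J Φ_λ̄' = (B0(x) + λ̄ B1(x)) Φ_λ̄ with Φ_λ(c) = Φ_λ̄(c) = I_{2n}. Define A(x;λ) := (1/(2 Im λ)) Φ_λ(x)* (J/i) Φ_λ(x) and A(x;λ̄) := (1/(2 Im λ̄)) Φ_λ̄(x)* (J/i) Φ_λ̄(x). Then for every x ∈ (a,b) and every ρ ∈ ℝ with ρ ≠ 0: ρ is an eigenvalue of A(x;λ̄) if and only if -1/((2 Im λ)² ρ) is an eigenvalue of A(x;λ); moreover, if v ∈ ℂ^{2n} is a nonzero vector with A(x;λ̄) v = ρ v, then (J/i)v is nonzero and A(x;λ) ((J/i)v) = (-1/((2 Im λ)² ρ)) (J/i)v. -/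
open Matrix Set

noncomputable section

theorem conjTranspose_stdJi (n : ℕ) : (stdJi n)ᴴ = stdJi n := by
  simp [stdJi, conjTranspose_stdJ, Matrix.conjTranspose_smul]

theorem stdJi_mul_stdJi (n : ℕ) : stdJi n * stdJi n = 1 := by
  have h : stdJ n * stdJ n = -1 := by
    simp [stdJ, Matrix.fromBlocks_multiply, ← Matrix.fromBlocks_one, Matrix.fromBlocks_neg]
  simp [stdJi, h, smul_smul]

theorem hasDerivAt_mul_apply {m : Type*} [Fintype m]
    {F G F' G' : ℝ → Matrix m m ℂ} {x : ℝ}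
    (hF : ∀ i j, HasDerivAt (fun t => F t i j) (F' x i j) x)
    (hG : ∀ i j, HasDerivAt (fun t => G t i j) (G' x i j) x) (i j : m) :
    HasDerivAt (fun t => (F t * G t) i j) ((F' x * G x + F x * G' x) i j) x := by
  simp only [Matrix.add_apply, Matrix.mul_apply, ← Finset.sum_add_distrib]
  exact HasDerivAt.fun_sum fun k _ => (hF i k).mul (hG k j)

theorem hasDerivAt_conjTranspose_apply {m : Type*}
    {F F' : ℝ → Matrix m m ℂ} {x : ℝ}
    (hF : ∀ i j, HasDerivAt (fun t => F t i j) (F' x i j) x) (i j : m) :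
    HasDerivAt (fun t => (F t)ᴴ i j) ((F' x)ᴴ i j) x :=
  (hF j i).star

/-- Lagrange identity: solutions for conjugate spectral parameters have constant `J`-product. -/
theorem conjTranspose_mul_stdJ_mul_eq {n : ℕ} {a b c : ℝ} (hc : c ∈ Ioo a b)
    {B0 B1 : ℝ → Matrix (Fin n ⊕ Fin n) (Fin n ⊕ Fin n) ℂ}
    (hB0 : ∀ x ∈ Ioo a b, (B0 x).IsHermitian)
    (hB1 : ∀ x ∈ Ioo a b, (B1 x).IsHermitian) {lam : ℂ}
    {Φ Φb DΦ DΦb : ℝ → Matrix (Fin n ⊕ Fin n) (Fin n ⊕ Fin n) ℂ}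
    (hΦ : ∀ x ∈ Ioo a b, ∀ i j, HasDerivAt (fun t => Φ t i j) (DΦ x i j) x)
    (hΦb : ∀ x ∈ Ioo a b, ∀ i j, HasDerivAt (fun t => Φb t i j) (DΦb x i j) x)
    (hODE : ∀ x ∈ Ioo a b, stdJ n * DΦ x = (B0 x + lam • B1 x) * Φ x)
    (hODEb : ∀ x ∈ Ioo a b,
      stdJ n * DΦb x = (B0 x + (starRingEnd ℂ lam) • B1 x) * Φb x)
    {x : ℝ} (hx : x ∈ Ioo a b) :
    (Φb x)ᴴ * (stdJ n * Φ x) = (Φb c)ᴴ * (stdJ n * Φ c) := by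
  have key : ∀ y ∈ Ioo a b, ∀ i j,
      HasDerivAt (fun t => ((Φb t)ᴴ * (stdJ n * Φ t)) i j) 0 y := by
    intro y hy i j
    have hJ : ∀ i j, HasDerivAt (fun t => (stdJ n * Φ t) i j) ((stdJ n * DΦ y) i j) y := by
      intro i j
      simpa using hasDerivAt_mul_apply (F := fun _ => stdJ n) (F' := fun _ => 0)
        (fun i j => hasDerivAt_const y (stdJ n i j)) (hΦ y hy) i j
    have h := hasDerivAt_mul_apply (F' := fun t => (DΦb t)ᴴ) (G' := fun t => stdJ n * DΦ t)
      (hasDerivAt_conjTranspose_apply (hΦb y hy)) hJ i j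
    have hb : (DΦb y)ᴴ * stdJ n = -((Φb y)ᴴ * (B0 y + lam • B1 y)) := by
      have := congrArg Matrix.conjTranspose (hODEb y hy)
      simp only [Matrix.conjTranspose_mul, conjTranspose_stdJ, Matrix.conjTranspose_add,
        Matrix.conjTranspose_smul, (hB0 y hy).eq, (hB1 y hy).eq, starRingEnd_apply,
        star_star, mul_neg] at this
      rw [← this, neg_neg]
    convert h using 1
    rw [← mul_assoc, hb, hODE y hy]
    simp [mul_assoc]
  ext i j
  exact isOpen_Ioo.is_const_of_deriv_eq_zero isPreconnected_Ioo
    (fun y hy => (key y hy i j).differentiableAt.differentiableWithinAt)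
    (fun y hy => (key y hy i j).deriv) hx hc

theorem conjTranspose_calA (n : ℕ) (lam : ℂ)
    (Φ : ℝ → Matrix (Fin n ⊕ Fin n) (Fin n ⊕ Fin n) ℂ) (x : ℝ) :
    (calA n lam Φ x)ᴴ = calA n lam Φ x := by
  simp [calA, Matrix.conjTranspose_smul, conjTranspose_stdJi, mul_assoc]

theorem calA_mul_stdJi_mul_calA {n : ℕ} {lam : ℂ}
    {Φ Φb : ℝ → Matrix (Fin n ⊕ Fin n) (Fin n ⊕ Fin n) ℂ} {x : ℝ}
    (h : (Φb x)ᴴ * (stdJi n * Φ x) = stdJi n) :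
    calA n lam Φ x * (stdJi n * calA n (starRingEnd ℂ lam) Φb x) =
      (-(1 / (2 * (lam.im : ℂ)) ^ 2)) • stdJi n := by
  have hK := stdJi_mul_stdJi n
  have h1 : (Φ x)ᴴ * (stdJi n * Φb x) = stdJi n := by
    simpa [conjTranspose_stdJi, mul_assoc] using congrArg Matrix.conjTranspose h
  have h2 : (Φ x * (stdJi n * (Φb x)ᴴ)) * stdJi n = 1 := by
    have : (stdJi n * (Φb x)ᴴ * stdJi n) * Φ x = 1 := by
      rw [mul_assoc, mul_assoc, h, hK]
    simpa [mul_assoc] using mul_eq_one_comm.mp this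
  have h3 : (Φ x)ᴴ * stdJi n * Φ x * (stdJi n * ((Φb x)ᴴ * stdJi n * Φb x)) = stdJi n := by
    calc _ = (Φ x)ᴴ * stdJi n * ((Φ x * (stdJi n * (Φb x)ᴴ)) * stdJi n) * Φb x := by
          simp only [mul_assoc]
      _ = stdJi n := by rw [h2, mul_one, mul_assoc, h1]
  simp only [calA, smul_mul_assoc, mul_smul_comm, h3, smul_smul, Complex.conj_im]
  congr 1
  push_cast
  ring

theorem mulVec_mulVec_of_mul_mul_eq_smul {m : Type*} [Fintype m]
    {A K B : Matrix m m ℂ} {s r t : ℂ} (hr : r ≠ 0) (hs : s = t * r)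
    (h : A * (K * B) = s • K) {v : m → ℂ} (hv : B.mulVec v = r • v) :
    A.mulVec (K.mulVec v) = t • K.mulVec v := by
  have := congrArg (fun M => M.mulVec v) h
  simp only [← Matrix.mulVec_mulVec, hv, Matrix.mulVec_smul, Matrix.smul_mulVec] at this
  apply smul_right_injective _ hr
  simp only [this, hs, smul_smul, mul_comm]

theorem stdJi_mulVec_ne_zero {n : ℕ} {v : Fin n ⊕ Fin n → ℂ} (hv : v ≠ 0) :
    (stdJi n).mulVec v ≠ 0 := by
  intro h
  apply hv
  rw [← Matrix.one_mulVec v, ← stdJi_mul_stdJi, ← Matrix.mulVec_mulVec, h, Matrix.mulVec_zero]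

/-- For nonzero real `ρ`: `ρ` is an eigenvalue of `A(x;λ̄)` iff `-1/((2 Im λ)² ρ)` is an
eigenvalue of `A(x;λ)`; and if `A(x;λ̄) v = ρ v` with `v ≠ 0`, then `(J/i)v ≠ 0` and
`A(x;λ) ((J/i)v) = (-1/((2 Im λ)² ρ)) (J/i)v`. -/
theorem calA_eigenvalue_correspondence
    (n : ℕ) (hn : 1 ≤ n) (a b : ℝ) (hab : a < b)
    (B0 B1 : ℝ → Matrix (Fin n ⊕ Fin n) (Fin n ⊕ Fin n) ℂ)
    (hB0 : ∀ x ∈ Ioo a b, (B0 x).IsHermitian)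
    (hB1 : ∀ x ∈ Ioo a b, (B1 x).IsHermitian)
    (c : ℝ) (hc : c ∈ Ioo a b) (lam : ℂ) (hlam : lam.im ≠ 0)
    (Φ Φb DΦ DΦb : ℝ → Matrix (Fin n ⊕ Fin n) (Fin n ⊕ Fin n) ℂ)
    (hΦ : ∀ x ∈ Ioo a b, ∀ i j, HasDerivAt (fun t => Φ t i j) (DΦ x i j) x)
    (hΦb : ∀ x ∈ Ioo a b, ∀ i j, HasDerivAt (fun t => Φb t i j) (DΦb x i j) x)
    (hODE : ∀ x ∈ Ioo a b, stdJ n * DΦ x = (B0 x + lam • B1 x) * Φ x)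
    (hODEb : ∀ x ∈ Ioo a b,
      stdJ n * DΦb x = (B0 x + (starRingEnd ℂ lam) • B1 x) * Φb x)
    (hΦc : Φ c = 1) (hΦbc : Φb c = 1) :
    ∀ x ∈ Ioo a b, ∀ ρ : ℝ, ρ ≠ 0 →
      ((∃ v : (Fin n ⊕ Fin n) → ℂ, v ≠ 0 ∧
          (calA n (starRingEnd ℂ lam) Φb x).mulVec v = (ρ : ℂ) • v) ↔
        (∃ w : (Fin n ⊕ Fin n) → ℂ, w ≠ 0 ∧
          (calA n lam Φ x).mulVec w = (((-1 / ((2 * lam.im) ^ 2 * ρ) : ℝ)) : ℂ) • w)) ∧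
      (∀ v : (Fin n ⊕ Fin n) → ℂ, v ≠ 0 →
        (calA n (starRingEnd ℂ lam) Φb x).mulVec v = (ρ : ℂ) • v →
        (stdJi n).mulVec v ≠ 0 ∧
        (calA n lam Φ x).mulVec ((stdJi n).mulVec v) =
          (((-1 / ((2 * lam.im) ^ 2 * ρ) : ℝ)) : ℂ) • (stdJi n).mulVec v) := by
  intro x hx ρ hρ
  have hW : (Φb x)ᴴ * (stdJi n * Φ x) = stdJi n := by
    have := conjTranspose_mul_stdJ_mul_eq hc hB0 hB1 hΦ hΦb hODE hODEb hx
    simp only [hΦc, hΦbc, Matrix.conjTranspose_one, mul_one, one_mul] at this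
    simp only [stdJi, smul_mul_assoc, mul_smul_comm, this]
  have hA := calA_mul_stdJi_mul_calA (lam := lam) hW
  have hA' : calA n (starRingEnd ℂ lam) Φb x * (stdJi n * calA n lam Φ x) =
      (-(1 / (2 * (lam.im : ℂ)) ^ 2)) • stdJi n := by
    simpa [Matrix.conjTranspose_smul, conjTranspose_calA, conjTranspose_stdJi, mul_assoc] using
      congrArg Matrix.conjTranspose hA
  have hlam' : (lam.im : ℂ) ≠ 0 := by exact_mod_cast hlam
  have hρ' : (ρ : ℂ) ≠ 0 := by exact_mod_cast hρ
  have hσ : ((-1 / ((2 * lam.im) ^ 2 * ρ) : ℝ) : ℂ) ≠ 0 := by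
    push_cast
    exact div_ne_zero (by simp) (mul_ne_zero (pow_ne_zero _ (mul_ne_zero two_ne_zero hlam')) hρ')
  have hs : -(1 / (2 * (lam.im : ℂ)) ^ 2) = ((-1 / ((2 * lam.im) ^ 2 * ρ) : ℝ) : ℂ) * ρ := by
    push_cast
    field_simp
  have forward := fun (v : Fin n ⊕ Fin n → ℂ) hv =>
    mulVec_mulVec_of_mul_mul_eq_smul (v := v) hρ' hs hA hv
  refine ⟨⟨?_, ?_⟩, fun v hv h => ⟨stdJi_mulVec_ne_zero hv, forward v h⟩⟩
  · rintro ⟨v, hv, h⟩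
    exact ⟨_, stdJi_mulVec_ne_zero hv, forward v h⟩
  · rintro ⟨w, hw, h⟩
    exact ⟨_, stdJi_mulVec_ne_zero hw,
      mulVec_mulVec_of_mul_mul_eq_smul hσ (hs.trans (mul_comm _ _)) hA' h⟩
end
end

section
/- Let n ≥ 1, let 0 ≤ r ≤ n, let (u_k)_{k=1}^{2n} be an orthonormal family in ℂ^{2n} and (ū_k)_{k=1}^{2n} an orthonormal family in ℂ^{2n} satisfying u_{n+j} = (J/i) ū_j and ū_{n+j} = (J/i) u_j for all 1 ≤ j ≤ n, and u_{j-n} = (J/i) ū_j and ū_{j-n} = (J/i) u_j for all n+1 ≤ j ≤ 2n. Let β_1, …, β_r ∈ ℂ and set β̄_j := -conj(β_j) for 1 ≤ j ≤ r. Define r_j := u_j + β_j u_{n+j} and r̄_j := ū_j + β̄_j ū_{n+j} for 1 ≤ j ≤ r, and r_j := u_j, r̄_j := ū_j for r+1 ≤ j ≤ n. Then r̄_j* J r_k = 0 for all 1 ≤ j, k ≤ n; equivalently, if R ∈ ℂ^{2n×n} has columns r_1, …, r_n and R̄ ∈ ℂ^{2n×n} has columns r̄_1, …, r̄_n, then R̄*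 J R = 0. -/
open Matrix

noncomputable section

theorem stdJ_mulVec (n : ℕ) (v : Fin n ⊕ Fin n → ℂ) :
    (stdJ n).mulVec v = Complex.I • (stdJi n).mulVec v := by
  rw [stdJi, smul_mulVec, smul_smul]
  simp

/-- Key algebraic identity behind `R^b(λ̄)* J R^b(λ) = 0`: given two orthonormal families `u`
and `ū` related by `J/i` as stated, and `β̄_j = -conj β_j`, the frames with columns
`r_j = u_j + β_j u_{n+j}` (for `j < r`), `r_j = u_j` (for `j ≥ r`), and analogously `r̄_j`,
satisfy `r̄_j* J r_k = 0` for all `j,k`; equivalently `R̄ᴴ J R = 0`. -/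
theorem frames_conj_J_orthogonal
    (n r : ℕ) (hn : 1 ≤ n) (hr : r ≤ n)
    (u ub : (Fin n ⊕ Fin n) → ((Fin n ⊕ Fin n) → ℂ))
    (hortho : ∀ j k, star (u j) ⬝ᵥ u k = if j = k then 1 else 0)
    (horthob : ∀ j k, star (ub j) ⬝ᵥ ub k = if j = k then 1 else 0)
    (hrel1 : ∀ j : Fin n, u (Sum.inr j) = (stdJi n).mulVec (ub (Sum.inl j)))
    (hrel2 : ∀ j : Fin n, ub (Sum.inr j) = (stdJi n).mulVec (u (Sum.inl j)))
    (hrel3 : ∀ j : Fin n, u (Sum.inl j) = (stdJi n).mulVec (ub (Sum.inr j)))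
    (hrel4 : ∀ j : Fin n, ub (Sum.inl j) = (stdJi n).mulVec (u (Sum.inr j)))
    (β βb : Fin n → ℂ)
    (hβb : ∀ j : Fin n, βb j = -(starRingEnd ℂ) (β j))
    (rvec rbvec : Fin n → ((Fin n ⊕ Fin n) → ℂ))
    (hrvec : ∀ j : Fin n, rvec j =
      if (j : ℕ) < r then u (Sum.inl j) + β j • u (Sum.inr j) else u (Sum.inl j))
    (hrbvec : ∀ j : Fin n, rbvec j =
      if (j : ℕ) < r then ub (Sum.inl j) + βb j • ub (Sum.inr j) else ub (Sum.inl j)) :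
    (∀ j k : Fin n, star (rbvec j) ⬝ᵥ (stdJ n).mulVec (rvec k) = 0) ∧
    (Matrix.of fun i j => rbvec j i)ᴴ * stdJ n * (Matrix.of fun i j => rvec j i) = 0 := by
  have h : ∀ j k : Fin n, star (rbvec j) ⬝ᵥ (stdJ n).mulVec (rvec k) = 0 := by
    intro j k
    have hl : (stdJ n).mulVec (u (Sum.inl k)) = Complex.I • ub (Sum.inr k) := by
      rw [stdJ_mulVec, hrel2]
    have hinr : (stdJ n).mulVec (u (Sum.inr k)) = Complex.I • ub (Sum.inl k) := by
      rw [stdJ_mulVec, hrel4]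
    rw [hrvec, hrbvec]
    by_cases hjk : j = k
    · subst hjk
      split_ifs <;> simp [mulVec_add, mulVec_smul, hl, hinr, horthob, hβb, mul_comm]
    · split_ifs <;> simp [mulVec_add, mulVec_smul, hl, hinr, horthob, hjk]
  refine ⟨h, ?_⟩
  ext j k
  rw [Matrix.mul_assoc]
  exact h j k
end
end

section
/- Let n ≥ 1 and let X₁, X₂ ∈ ℂ^{2n×n} each satisfy rank Xᵢ = n and Xᵢ* J Xᵢ = 0 (i.e., each is a frame for a Lagrangian subspace of ℂ^{2n}). Let ℓ₁ = range(X₁) and ℓ₂ = range(X₂) be the column spans. Then dim_ℂ (ℓ₁ ∩ ℓ₂) = dim_ℂ ker(X₁* J X₂), where X₁* J X₂ is regarded as a linear map ℂⁿ → ℂⁿ. -/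
open Matrix

noncomputable section

/-- The symplectic matrix `J` is invertible. -/
theorem isUnit_det_stdJ (n : ℕ) : IsUnit (stdJ n).det := by
  refine (Matrix.isUnit_iff_isUnit_det _).mp
    (IsUnit.of_mul_eq_one (Matrix.fromBlocks 0 1 (-1) 0) ?_)
  simp [stdJ, Matrix.fromBlocks_multiply, Matrix.fromBlocks_one]

open scoped ComplexOrder in
/-- A Lagrangian subspace with frame `X` is its own symplectic complement. -/
theorem range_eq_ker_conjTranspose_mul_stdJ {n : ℕ} {X : Matrix (Fin n ⊕ Fin n) (Fin n) ℂ}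
    (hrank : X.rank = n) (hiso : Xᴴ * stdJ n * X = 0) :
    LinearMap.range X.mulVecLin = LinearMap.ker (Xᴴ * stdJ n).mulVecLin := by
  apply Submodule.eq_of_le_of_finrank_eq
  · rw [LinearMap.range_le_ker_iff, ← Matrix.mulVecLin_mul, hiso, Matrix.mulVecLin_zero]
  · have hrange : Module.finrank ℂ (LinearMap.range X.mulVecLin) = n := hrank
    have hrank' : Module.finrank ℂ (LinearMap.range (Xᴴ * stdJ n).mulVecLin) = n := by
      change (Xᴴ * stdJ n).rank = n
      rw [Matrix.rank_mul_eq_left_of_isUnit_det _ _ (isUnit_det_stdJ n),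
        Matrix.rank_conjTranspose, hrank]
    have hdim := (Xᴴ * stdJ n).mulVecLin.finrank_range_add_finrank_ker
    simp only [Module.finrank_fintype_fun_eq_card, Fintype.card_sum, Fintype.card_fin] at hdim
    omega

/-- A frame acts injectively on coordinate vectors. -/
theorem mulVecLin_injective_of_rank_eq {m : Type*} [Fintype m] {n : ℕ} {X : Matrix m (Fin n) ℂ}
    (hrank : X.rank = n) : Function.Injective X.mulVecLin := by
  rw [← LinearMap.ker_eq_bot, ← Submodule.finrank_eq_zero]
  have hrange : Module.finrank ℂ (LinearMap.range X.mulVecLin) = n := hrank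
  have hdim := X.mulVecLin.finrank_range_add_finrank_ker
  simp only [Module.finrank_fintype_fun_eq_card, Fintype.card_fin] at hdim
  omega

/-- For Lagrangian frames `X₁, X₂`, the dimension of the intersection of their column
spans equals the dimension of the kernel of `X₁ᴴ J X₂ : ℂⁿ → ℂⁿ`. -/
theorem dim_intersection_eq_dim_ker_wronskian
    (n : ℕ) (hn : 1 ≤ n)
    (X₁ X₂ : Matrix (Fin n ⊕ Fin n) (Fin n) ℂ)
    (hrank₁ : X₁.rank = n) (hrank₂ : X₂.rank = n)
    (hiso₁ : X₁ᴴ * stdJ n * X₁ = 0) (hiso₂ : X₂ᴴ * stdJ n * X₂ = 0) :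
    Module.finrank ℂ
        ↥(LinearMap.range X₁.mulVecLin ⊓ LinearMap.range X₂.mulVecLin) =
      Module.finrank ℂ ↥(LinearMap.ker (X₁ᴴ * stdJ n * X₂).mulVecLin) := by
  rw [Matrix.mulVecLin_mul, LinearMap.ker_comp,
    ← range_eq_ker_conjTranspose_mul_stdJ hrank₁ hiso₁, inf_comm, ← Submodule.map_comap_eq]
  exact (Submodule.equivMapOfInjective _ (mulVecLin_injective_of_rank_eq hrank₂) _).finrank_eq.symm
end
end
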